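/- Let F be a Minkowski norm on a finite-dimensional real vector space E and let V ∈ E satisfy F(−V) > 1. Then the set A := { y + F(y)·V : y ∈ E ∖ {0}, g_y(y,V) < −F(y) } is a nonempty open convex cone in E (i.e., it is nonempty, open, convex, closed under multiplication by positive scalars) and does not contain 0. -/

import Mathlib

/-- The fundamental tensor of a (Minkowski-type) norm `F` at `y`:
`g_y(u,v) = (1/2) D²(F²)(y)(u,v)`. -/
noncomputable def fundTensor {E : Type*} [NormedAddCommGroup E] [NormedSpace ℝ E]
    (F : E → ℝ) (y u v : E) : ℝ :=
  (1 / 2) * iteratedFDeriv ℝ 2 (fun z => (F z) ^ 2) y ![u, v]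

/-- A Minkowski norm on a finite dimensional real vector space `E`. -/
structure IsMinkowskiNorm {E : Type*} [NormedAddCommGroup E] [NormedSpace ℝ E]
    (F : E → ℝ) : Prop where
  map_zero : F 0 = 0
  pos : ∀ y : E, y ≠ 0 → 0 < F y
  smooth : ContDiffOn ℝ (⊤ : ℕ∞) F {(0 : E)}ᶜ
  homog : ∀ t : ℝ, 0 < t → ∀ y : E, F (t • y) = t * F y
  symm : ∀ y : E, y ≠ 0 → ∀ u v : E, fundTensor F y u v = fundTensor F y v u
  posdef : ∀ y : E, y ≠ 0 → ∀ u : E, u ≠ 0 → 0 < fundTensor F y u u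

open Set Filter Topology

namespace IsMinkowskiNorm

variable {E : Type*} [NormedAddCommGroup E] [NormedSpace ℝ E] {F : E → ℝ}

theorem nonneg (hF : IsMinkowskiNorm F) (y : E) : 0 ≤ F y := by
  rcases eq_or_ne y 0 with rfl | hy
  · exact hF.map_zero.ge
  · exact (hF.pos y hy).le

theorem homog_of_nonneg (hF : IsMinkowskiNorm F) {t : ℝ} (ht : 0 ≤ t) (y : E) :
    F (t • y) = t * F y := by
  rcases ht.eq_or_lt with rfl | ht
  · simp [hF.map_zero]
  · exact hF.homog t ht y

theorem contDiffAt (hF : IsMinkowskiNorm F) {y : E} (hy : y ≠ 0) :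
    ContDiffAt ℝ (⊤ : ℕ∞) F y :=
  hF.smooth.contDiffAt (isOpen_compl_singleton.mem_nhds hy)

theorem hasFDerivAt (hF : IsMinkowskiNorm F) {y : E} (hy : y ≠ 0) :
    HasFDerivAt F (fderiv ℝ F y) y :=
  ((hF.contDiffAt hy).differentiableAt (by simp)).hasFDerivAt

theorem hasFDerivAt_sq (hF : IsMinkowskiNorm F) {y : E} (hy : y ≠ 0) :
    HasFDerivAt (fun z => F z ^ 2) (fderiv ℝ (fun z => F z ^ 2) y) y :=
  (((hF.contDiffAt hy).pow 2).differentiableAt (by simp)).hasFDerivAt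

theorem hasFDerivAt_fderiv_sq (hF : IsMinkowskiNorm F) {y : E} (hy : y ≠ 0) :
    HasFDerivAt (fderiv ℝ fun z => F z ^ 2) (fderiv ℝ (fderiv ℝ fun z => F z ^ 2) y) y := by
  have h : ContDiffAt ℝ 1 (fderiv ℝ fun z => F z ^ 2) y :=
    ((hF.contDiffAt hy).pow 2).fderiv_right (by norm_cast)
  exact (h.differentiableAt one_ne_zero).hasFDerivAt

theorem fderiv_sq_apply (hF : IsMinkowskiNorm F) {y : E} (hy : y ≠ 0) (v : E) :
    fderiv ℝ (fun z => F z ^ 2) y v = 2 * F y * fderiv ℝ F y v := by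
  rw [((hF.hasFDerivAt hy).pow 2).fderiv]
  simp

/-- Euler's identity for the 1-homogeneous function `F`. -/
theorem fderiv_self (hF : IsMinkowskiNorm F) {y : E} (hy : y ≠ 0) :
    fderiv ℝ F y y = F y := by
  have hline : HasDerivAt (fun t : ℝ => t • y) y 1 := by
    simpa using (hasDerivAt_id (1 : ℝ)).smul_const y
  have h₁ : HasDerivAt (fun t : ℝ => F (t • y)) (fderiv ℝ F y y) 1 :=
    HasFDerivAt.comp_hasDerivAt (1 : ℝ) (by simpa using hF.hasFDerivAt hy) hline
  have h₂ : HasDerivAt (fun t : ℝ => t * F y) (F y) 1 := by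
    simpa using (hasDerivAt_id (1 : ℝ)).mul_const (F y)
  refine h₁.unique (h₂.congr_of_eventuallyEq ?_)
  filter_upwards [lt_mem_nhds (zero_lt_one' ℝ)] with t ht using hF.homog t ht y

theorem fundTensor_eq (F : E → ℝ) (y u v : E) :
    fundTensor F y u v = 1 / 2 * fderiv ℝ (fderiv ℝ fun z => F z ^ 2) y u v := by
  simp [fundTensor, iteratedFDeriv_two_apply]

theorem fundTensor_self_left (hF : IsMinkowskiNorm F) {y : E} (hy : y ≠ 0) (v : E) :
    fundTensor F y y v = F y * fderiv ℝ F y v := by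
  have h₁ : HasFDerivAt (fun z => fderiv ℝ (fun z => F z ^ 2) z z) _ y :=
    (hF.hasFDerivAt_fderiv_sq hy).clm_apply (hasFDerivAt_id y)
  have h₂ : HasFDerivAt (fun z => 2 * F z ^ 2) _ y := (hF.hasFDerivAt_sq hy).const_mul 2
  have heq : (fun z => fderiv ℝ (fun z => F z ^ 2) z z) =ᶠ[𝓝 y] fun z => 2 * F z ^ 2 := by
    filter_upwards [isOpen_compl_singleton.mem_nhds hy] with z hz
    rw [hF.fderiv_sq_apply hz, hF.fderiv_self hz]
    ring
  have h := DFunLike.congr_fun (h₁.unique (h₂.congr_of_eventuallyEq heq)) v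
  simp only [add_apply, ContinuousLinearMap.comp_apply,
    ContinuousLinearMap.flip_apply, smul_apply, smul_eq_mul,
    ContinuousLinearMap.id_apply, hF.fderiv_sq_apply hy] at h
  rw [hF.symm y hy, fundTensor_eq]
  linarith

theorem convexOn_sq_line (hF : IsMinkowskiNorm F) (x v : E)
    (h0 : ∀ t ∈ Icc (0 : ℝ) 1, x + t • v ≠ 0) :
    ConvexOn ℝ (Icc (0 : ℝ) 1) fun t => F (x + t • v) ^ 2 := by
  have hline (t : ℝ) : HasDerivAt (fun t : ℝ => x + t • v) v t := by
    simpa using ((hasDerivAt_id t).smul_const v).const_add x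
  have hd : ∀ t ∈ Icc (0 : ℝ) 1, HasDerivAt (fun t => F (x + t • v) ^ 2)
      (fderiv ℝ (fun z => F z ^ 2) (x + t • v) v) t := fun t ht =>
    HasFDerivAt.comp_hasDerivAt (l := fun z => F z ^ 2) t (hF.hasFDerivAt_sq (h0 t ht)) (hline t)
  refine convexOn_of_hasDerivWithinAt2_nonneg (convex_Icc 0 1)
    (f'' := fun t => fderiv ℝ (fderiv ℝ fun z => F z ^ 2) (x + t • v) v v)
    (fun t ht => (hd t ht).continuousAt.continuousWithinAt)
    (fun t ht => (hd t (interior_subset ht)).hasDerivWithinAt) (fun t ht => ?_) (fun t ht => ?_)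
  · have h₁ : HasDerivAt (fun t => fderiv ℝ (fun z => F z ^ 2) (x + t • v)) _ t :=
      HasFDerivAt.comp_hasDerivAt (l := fderiv ℝ fun z => F z ^ 2) t
        (hF.hasFDerivAt_fderiv_sq (h0 t (interior_subset ht))) (hline t)
    have h₂ := h₁.clm_apply (hasDerivAt_const t v)
    simpa only [ContinuousLinearMap.map_zero, add_zero] using h₂.hasDerivWithinAt
  · rcases eq_or_ne v 0 with rfl | hv
    · simp
    · have h := hF.posdef _ (h0 t (interior_subset ht)) v hv
      rw [fundTensor_eq] at h
      linarith

theorem map_smul_add_smul_le_of_eq_one (hF : IsMinkowskiNorm F) {a b : E} (ha : F a = 1)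
    (hb : F b = 1) {s t : ℝ} (hs : 0 < s) (ht : 0 < t) : F (s • a + t • b) ≤ s + t := by
  by_cases h0 : ∃ r ∈ Icc (0 : ℝ) 1, a + r • (b - a) = 0
  · obtain ⟨r, ⟨hr0, hr1⟩, hr⟩ := h0
    have ha0 : a ≠ 0 := by rintro rfl; simp [hF.map_zero] at ha
    have hr0 : 0 < r := hr0.lt_of_ne (by rintro rfl; simp [ha0] at hr)
    have hb' : b = (-((1 - r) / r)) • a := by
      have : r • b = (-(1 - r)) • a := by
        rw [← sub_eq_zero, ← hr]; module
      rw [← inv_smul_smul₀ hr0.ne' b, this, smul_smul]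
      congr 1; ring
    set c := (1 - r) / r
    have hc : 0 ≤ c := div_nonneg (by linarith) hr0.le
    rcases le_total (t * c) s with h | h
    · have : s • a + t • b = (s - t * c) • a := by rw [hb']; module
      rw [this, hF.homog_of_nonneg (by linarith), ha]
      nlinarith
    · have hc' : 0 < c := by
        by_contra hc'
        nlinarith
      have ha' : a = (-c⁻¹) • b := by
        rw [hb', smul_smul, neg_mul_neg, inv_mul_cancel₀ hc'.ne', one_smul]
      have hst : s * c⁻¹ ≤ t := by
        rw [← div_eq_mul_inv, div_le_iff₀ hc']; exact h
      have : s • a + t • b = (t - s * c⁻¹) • b := by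
        conv_lhs => rw [ha']
        module
      rw [this, hF.homog_of_nonneg (by linarith), hb]
      have := mul_pos hs (inv_pos.2 hc')
      linarith
  · push Not at h0
    have hst : 0 < s + t := by positivity
    have hw : s / (s + t) + t / (s + t) = 1 := by field_simp
    have h := (hF.convexOn_sq_line a (b - a) h0).2 (left_mem_Icc.2 zero_le_one)
      (right_mem_Icc.2 zero_le_one)
      (show 0 ≤ s / (s + t) by positivity) (show 0 ≤ t / (s + t) by positivity) hw
    simp only [smul_eq_mul, mul_zero, mul_one, zero_add, zero_smul, add_zero, one_smul,
      add_sub_cancel, ha, hb, one_pow, hw] at h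
    have hcomb : s • a + t • b = (s + t) • (a + (t / (s + t)) • (b - a)) := by
      rw [smul_add, smul_smul, mul_div_cancel₀ _ hst.ne']
      module
    rw [hcomb, hF.homog _ hst]
    have := (sq_le_one_iff₀ (hF.nonneg _)).1 h
    nlinarith

theorem map_add_le (hF : IsMinkowskiNorm F) (x y : E) : F (x + y) ≤ F x + F y := by
  rcases eq_or_ne x 0 with rfl | hx
  · simp [hF.map_zero]
  rcases eq_or_ne y 0 with rfl | hy
  · simp [hF.map_zero]
  have key {z : E} (hz : z ≠ 0) : F ((F z)⁻¹ • z) = 1 := by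
    rw [hF.homog _ (inv_pos.2 (hF.pos z hz)), inv_mul_cancel₀ (hF.pos z hz).ne']
  simpa [smul_smul, (hF.pos x hx).ne', (hF.pos y hy).ne'] using
    hF.map_smul_add_smul_le_of_eq_one (key hx) (key hy) (hF.pos x hx) (hF.pos y hy)

theorem convexOn (hF : IsMinkowskiNorm F) : ConvexOn ℝ univ F := by
  refine ⟨convex_univ, fun x _ y _ a b ha hb _ => ?_⟩
  rw [smul_eq_mul, smul_eq_mul, ← hF.homog_of_nonneg ha, ← hF.homog_of_nonneg hb]
  exact hF.map_add_le _ _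

theorem continuous [FiniteDimensional ℝ E] (hF : IsMinkowskiNorm F) : Continuous F :=
  hF.convexOn.locallyLipschitz.continuous

theorem hasDerivAt_line (hF : IsMinkowskiNorm F) {y : E} (hy : y ≠ 0) (v : E) :
    HasDerivAt (fun t : ℝ => F (y + t • v)) (fderiv ℝ F y v) 0 := by
  have hline : HasDerivAt (fun t : ℝ => y + t • v) v 0 := by
    simpa using ((hasDerivAt_id (0 : ℝ)).smul_const v).const_add y
  exact HasFDerivAt.comp_hasDerivAt (0 : ℝ) (by simpa using hF.hasFDerivAt hy) hline

/-- The fundamental inequality of a Minkowski norm. -/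
theorem fderiv_apply_le (hF : IsMinkowskiNorm F) {y : E} (hy : y ≠ 0) (v : E) :
    fderiv ℝ F y v ≤ F v := by
  have h : Tendsto (slope (fun t : ℝ => F (y + t • v)) 0) (𝓝[>] 0) (𝓝 (fderiv ℝ F y v)) :=
    (hasDerivWithinAt_iff_tendsto_slope' (lt_irrefl (0 : ℝ))).1
      (hF.hasDerivAt_line hy v).hasDerivWithinAt
  refine le_of_tendsto h ?_
  filter_upwards [self_mem_nhdsWithin] with t ht
  have ht : 0 < t := ht
  have hle := hF.map_add_le y (t • v)
  rw [hF.homog t ht] at hle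
  rw [slope_def_field, div_le_iff₀ (by simpa using ht)]
  simp only [zero_smul, add_zero, sub_zero]
  linarith

/-- The navigation cone is the positive cone spanned by the translated unit ball
`V + {F < 1}`. -/
theorem navigation_cone_eq [FiniteDimensional ℝ E] (hF : IsMinkowskiNorm F) {V : E}
    (hV : 1 < F (-V)) :
    {w : E | ∃ y : E, y ≠ 0 ∧ fundTensor F y y V < -(F y) ∧ w = y + F y • V} =
      {w : E | ∃ t : ℝ, F (w - t • V) < t} := by
  ext w
  constructor
  · rintro ⟨y, hy, hg, rfl⟩
    have hpos := hF.pos y hy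
    rw [hF.fundTensor_self_left hy] at hg
    have hlt : fderiv ℝ F y V < -1 := by
      by_contra! h
      nlinarith
    obtain ⟨t, hs, ht⟩ := (((hF.hasDerivAt_line hy V).hasDerivWithinAt
      (s := Ioi 0)).limsup_slope_le' (lt_irrefl 0) hlt).and self_mem_nhdsWithin |>.exists
    have ht : 0 < t := ht
    rw [slope_def_field, div_lt_iff₀ (by simpa using ht)] at hs
    simp only [zero_smul, add_zero, sub_zero] at hs
    refine ⟨F y - t, ?_⟩
    have : y + F y • V - (F y - t) • V = y + t • V := by module
    rw [this]
    linarith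
  · rintro ⟨s, hs⟩
    set φ : ℝ → ℝ := fun t => F (w - t • V) - t
    have hφ : Continuous φ :=
      (hF.continuous.comp (by fun_prop)).sub continuous_id
    have hs0 : 0 < s := (hF.nonneg _).trans_lt hs
    have hV' : 0 < F (-V) - 1 := by linarith
    set b := max s (F (-w) / (F (-V) - 1))
    have hb : 0 ≤ φ b := by
      have h₁ := hF.map_add_le (w - b • V) (-w)
      have h₂ : w - b • V + -w = b • (-V) := by module
      have h₃ : F (-w) ≤ b * (F (-V) - 1) := (div_le_iff₀ hV').1 (le_max_right _ _)
      rw [h₂, hF.homog_of_nonneg (hs0.le.trans (le_max_left _ _))] at h₁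
      simp only [φ]
      linarith
    obtain ⟨t, ⟨hst, -⟩, ht⟩ := intermediate_value_Icc (le_max_left s _) hφ.continuousOn
      ⟨show φ s ≤ 0 by simp only [φ]; linarith, hb⟩
    have ht : F (w - t • V) = t := sub_eq_zero.1 ht
    have hy : w - t • V ≠ 0 := by
      intro h
      rw [h, hF.map_zero] at ht
      linarith
    refine ⟨w - t • V, hy, ?_, by rw [ht]; module⟩
    rw [hF.fundTensor_self_left hy]
    have h := hF.fderiv_apply_le hy (w - s • V)
    have hdec : w - s • V = (w - t • V) + (t - s) • V := by module
    rw [hdec, map_add, map_smul, hF.fderiv_self hy, smul_eq_mul, ← hdec, ht] at h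
    have hlt : fderiv ℝ F (w - t • V) V < -1 := by
      by_contra! h'
      nlinarith
    rw [ht]
    nlinarith

end IsMinkowskiNorm

/-- for a Minkowski norm `F` and `V` with `F(-V) > 1`, the set
`A = {y + F(y)·V : y ≠ 0, g_y(y,V) < -F(y)}` is a nonempty open convex cone
not containing `0`. -/
theorem lorentz_navigation_cone_isOpenConvexCone
    {E : Type*} [NormedAddCommGroup E] [NormedSpace ℝ E] [FiniteDimensional ℝ E]
    (F : E → ℝ) (hF : IsMinkowskiNorm F) (V : E) (hV : 1 < F (-V))
    (A : Set E)
    (hA : A = {w : E | ∃ y : E, y ≠ 0 ∧ fundTensor F y y V < -(F y) ∧ w = y + F y • V}) :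
    A.Nonempty ∧ IsOpen A ∧ Convex ℝ A ∧
      (∀ t : ℝ, 0 < t → ∀ w ∈ A, t • w ∈ A) ∧ (0 : E) ∉ A := by
  rw [hF.navigation_cone_eq hV] at hA
  subst hA
  refine ⟨⟨V, 1, by simp [hF.map_zero]⟩, ?_, ?_, ?_, ?_⟩
  · simp only [ofPred_exists]
    exact isOpen_iUnion fun t =>
      isOpen_lt (hF.continuous.comp (continuous_id.sub continuous_const)) continuous_const
  · rintro x ⟨s, hs⟩ y ⟨t, ht⟩ a b ha hb hab
    refine ⟨a * s + b * t, ?_⟩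
    have hdec : a • x + b • y - (a * s + b * t) • V = a • (x - s • V) + b • (y - t • V) := by
      module
    have h := hF.map_add_le (a • (x - s • V)) (b • (y - t • V))
    rw [hF.homog_of_nonneg ha, hF.homog_of_nonneg hb] at h
    rw [hdec]
    refine h.trans_lt ?_
    rcases ha.eq_or_lt with rfl | ha
    · have : b = 1 := by linarith
      subst this
      linarith
    · nlinarith
  · rintro c hc w ⟨t, ht⟩
    refine ⟨c * t, ?_⟩
    rw [mul_smul, ← smul_sub, hF.homog c hc]
    exact mul_lt_mul_of_pos_left ht hc
  · rintro ⟨t, ht⟩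
    have ht0 : 0 < t := (hF.nonneg _).trans_lt ht
    rw [zero_sub, ← smul_neg, hF.homog t ht0] at ht
    nlinarith
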